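/- arXiv:2004.05300 — 8 statements merged into one kernel-verified Lean document; each statement's English description precedes it below -/
import Mathlib

section
/- For all θ > 0, ν > 0 and γ > 0, the following identity holds: ∫_γ^∞ exp(−θx − νγ/x) dx = Σ_{k=0}^∞ ((−ν)^k / k!) · γ · E_k(θγ), where E_n(x) = ∫_1^∞ exp(−x t) t^{−n} dt is the generalized exponential integral; in particular the series on the right-hand side converges. -/
open MeasureTheory Filter Real

/-- The generalized exponential integral `E_n(x) = ∫_1^∞ exp(-x t) t^(-n) dt`. -/
noncomputable def genExpInt (n : ℕ) (x : ℝ) : ℝ :=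
  ∫ t in Set.Ioi (1 : ℝ), Real.exp (-x * t) * t ^ (-(n : ℤ))

/-- **Series expansion of the tail integral.** For `θ, ν, γ > 0`,
`∫_γ^∞ exp(-θ x - ν γ / x) dx = ∑_{k=0}^∞ ((-ν)^k / k!) γ E_k(θ γ)`, the series on the
right-hand side being convergent. -/
theorem integral_eq_series_genExpInt (θ ν γ : ℝ) (hθ : 0 < θ) (hν : 0 < ν) (hγ : 0 < γ) :
    Summable (fun k : ℕ => ((-ν) ^ k / (Nat.factorial k : ℝ)) * γ * genExpInt k (θ * γ)) ∧
    (∫ x in Set.Ioi γ, Real.exp (-θ * x - ν * γ / x)) =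
      ∑' k : ℕ, ((-ν) ^ k / (Nat.factorial k : ℝ)) * γ * genExpInt k (θ * γ) := by
  have hc : 0 < θ * γ := mul_pos hθ hγ
  have hexp : ∀ y : ℝ, HasSum (fun n : ℕ => y ^ n / (Nat.factorial n : ℝ)) (Real.exp y) := by
    intro y
    have h := NormedSpace.expSeries_div_hasSum_exp (𝔸 := ℝ) y
    rwa [← Real.exp_eq_exp_ℝ] at h
  have key : HasSum (fun k : ℕ => ∫ t in Set.Ioi (1 : ℝ),
      ((-ν) ^ k / (Nat.factorial k : ℝ)) * γ * (Real.exp (-(θ * γ) * t) * t ^ (-(k : ℤ))))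
      (∫ t in Set.Ioi (1 : ℝ), γ * Real.exp (-θ * (γ * t) - ν * γ / (γ * t))) := by
    have hb : ∀ t : ℝ, HasSum (fun k : ℕ =>
        γ * Real.exp (-(θ * γ) * t) * (ν ^ k / (Nat.factorial k : ℝ)))
        (γ * Real.exp (-(θ * γ) * t) * Real.exp ν) := fun t => (hexp ν).mul_left _
    refine hasSum_integral_of_dominated_convergence
      (fun k t => γ * Real.exp (-(θ * γ) * t) * (ν ^ k / (Nat.factorial k : ℝ))) ?_ ?_ ?_ ?_ ?_
    · intro k
      exact Measurable.aestronglyMeasurable (by fun_prop)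
    · intro k
      filter_upwards [ae_restrict_mem measurableSet_Ioi] with t ht
      have ht1 : (1 : ℝ) < t := ht
      have ht0 : (0 : ℝ) < t := by linarith
      have h1 : t ^ (-(k : ℤ)) ≤ 1 := by
        rw [zpow_neg, zpow_natCast]
        exact inv_le_one_of_one_le₀ (one_le_pow₀ ht1.le)
      have h0 : 0 ≤ t ^ (-(k : ℤ)) := by positivity
      rw [norm_mul, norm_mul, norm_mul, norm_div, norm_pow, norm_neg, Real.norm_of_nonneg hν.le,
        Real.norm_of_nonneg hγ.le, Real.norm_of_nonneg h0, Real.norm_of_nonneg (Real.exp_pos _).le,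
        Real.norm_of_nonneg (Nat.cast_nonneg _)]
      calc ν ^ k / (Nat.factorial k : ℝ) * γ * (Real.exp (-(θ * γ) * t) * t ^ (-(k : ℤ)))
          ≤ ν ^ k / (Nat.factorial k : ℝ) * γ * (Real.exp (-(θ * γ) * t) * 1) := by gcongr
        _ = _ := by ring
    · exact ae_of_all _ fun t => (hb t).summable
    · simp_rw [fun t => (hb t).tsum_eq]
      exact ((integrableOn_exp_mul_Ioi (a := -(θ * γ)) (by linarith) 1).const_mul γ).mul_const _
    · filter_upwards [ae_restrict_mem measurableSet_Ioi] with t ht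
      have ht1 : (1 : ℝ) < t := ht
      have ht0 : t ≠ 0 := by linarith
      have h := (hexp (-ν / t)).mul_left (γ * Real.exp (-(θ * γ) * t))
      have e1 : (fun k : ℕ => ((-ν) ^ k / (Nat.factorial k : ℝ)) * γ *
          (Real.exp (-(θ * γ) * t) * t ^ (-(k : ℤ)))) =
          fun k : ℕ => γ * Real.exp (-(θ * γ) * t) * ((-ν / t) ^ k / (Nat.factorial k : ℝ)) := by
        funext k
        rw [zpow_neg, zpow_natCast, div_pow]
        ring
      have e2 : γ * Real.exp (-θ * (γ * t) - ν * γ / (γ * t)) =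
          γ * Real.exp (-(θ * γ) * t) * Real.exp (-ν / t) := by
        rw [mul_assoc, ← Real.exp_add]
        congr 2
        field_simp
        ring
      rw [e1, e2]
      exact h
  have hL : (∫ t in Set.Ioi (1 : ℝ), γ * Real.exp (-θ * (γ * t) - ν * γ / (γ * t))) =
      ∫ x in Set.Ioi γ, Real.exp (-θ * x - ν * γ / x) := by
    rw [integral_const_mul,
      integral_comp_mul_left_Ioi (fun x => Real.exp (-θ * x - ν * γ / x)) 1 hγ, mul_one,
      smul_eq_mul, mul_inv_cancel_left₀ hγ.ne']
  rw [hL] at key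
  simp_rw [integral_const_mul] at key
  exact ⟨key.summable, key.tsum_eq.symm⟩
end

section
/- For every natural number n, the generalized exponential integral E_n(x) = ∫_1^∞ exp(−x t) t^{−n} dt satisfies lim_{x→∞} x e^x E_n(x) = 1. -/
open MeasureTheory Filter Real

/-- **Leading-order asymptotics of the generalized exponential integral:**
for every `n : ℕ`, `x e^x E_n(x) → 1` as `x → ∞`. -/
theorem genExpInt_asymptotic (n : ℕ) :
    Tendsto (fun x : ℝ => x * Real.exp x * genExpInt n x) atTop (nhds 1) := by
  have hup : ∀ t ∈ Set.Ioi (1 : ℝ), t ^ (-(n : ℤ)) ≤ 1 := by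
    intro t ht
    rw [zpow_neg, zpow_natCast]
    exact inv_le_one_of_one_le₀ (one_le_pow₀ (le_of_lt ht))
  have hlo : ∀ t ∈ Set.Ioi (1 : ℝ), Real.exp (n - n * t) ≤ t ^ (-(n : ℤ)) := by
    intro t ht
    have ht0 : (0 : ℝ) < t := lt_trans one_pos ht
    rw [zpow_neg, zpow_natCast, show (n : ℝ) - n * t = -(n * (t - 1)) by ring, Real.exp_neg,
      Real.exp_nat_mul]
    have h1 : t ≤ Real.exp (t - 1) := by
      have := Real.add_one_le_exp (t - 1)
      linarith
    gcongr
  have hlim : Tendsto (fun x : ℝ => 1 - (n : ℝ) / (x + n)) atTop (nhds 1) := by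
    have h : Tendsto (fun x : ℝ => (n : ℝ) / (x + n)) atTop (nhds 0) :=
      Tendsto.div_atTop tendsto_const_nhds (tendsto_atTop_add_const_right _ _ tendsto_id)
    simpa using h.const_sub 1
  have hint : ∀ x : ℝ, 0 < x →
      IntegrableOn (fun t : ℝ => Real.exp (-x * t) * t ^ (-(n : ℤ))) (Set.Ioi 1) := by
    intro x hx
    refine Integrable.mono' (integrableOn_exp_mul_Ioi (neg_lt_zero.mpr hx) 1) ?_ ?_
    · exact Measurable.aestronglyMeasurable (by
        simp only [zpow_neg, zpow_natCast]
        fun_prop)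
    · filter_upwards [ae_restrict_mem measurableSet_Ioi] with t ht
      have ht0 : (0 : ℝ) < t := lt_trans one_pos ht
      rw [Real.norm_of_nonneg (by positivity)]
      exact mul_le_of_le_one_right (Real.exp_pos _).le (hup t ht)
  refine tendsto_of_tendsto_of_tendsto_of_le_of_le' hlim tendsto_const_nhds ?_ ?_
  · filter_upwards [eventually_gt_atTop 0] with x hx
    have hxn : 0 < x + n := by positivity
    have hneg : -(x + n) < 0 := neg_lt_zero.mpr hxn
    have key : Real.exp n * (∫ t in Set.Ioi (1 : ℝ), Real.exp (-(x + n) * t))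
        ≤ genExpInt n x := by
      rw [← integral_const_mul]
      refine setIntegral_mono_on ((integrableOn_exp_mul_Ioi hneg 1).const_mul _) (hint x hx)
        measurableSet_Ioi ?_
      intro t ht
      rw [← Real.exp_add, show (n : ℝ) + -(x + n) * t = -x * t + (n - n * t) by ring,
        Real.exp_add]
      exact mul_le_mul_of_nonneg_left (hlo t ht) (Real.exp_pos _).le
    rw [integral_exp_mul_Ioi hneg] at key
    have h2 := mul_le_mul_of_nonneg_left key (mul_pos hx (Real.exp_pos x)).le
    refine le_trans (le_of_eq ?_) h2
    have h3 : Real.exp x * Real.exp n * Real.exp (-(x + n) * 1) = 1 := by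
      rw [← Real.exp_add, ← Real.exp_add, Real.exp_eq_one_iff]
      ring
    calc 1 - (n : ℝ) / (x + n) = x * 1 / (x + n) := by field_simp; ring
      _ = _ := by
        rw [neg_div_neg_eq]
        generalize Real.exp (-(x + n) * 1) = c at h3 ⊢
        rw [← h3]
        ring
  · filter_upwards [eventually_gt_atTop 0] with x hx
    have hneg : -x < 0 := neg_lt_zero.mpr hx
    have key : genExpInt n x ≤ ∫ t in Set.Ioi (1 : ℝ), Real.exp (-x * t) := by
      refine setIntegral_mono_on (hint x hx) (integrableOn_exp_mul_Ioi hneg 1)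
        measurableSet_Ioi ?_
      intro t ht
      exact mul_le_of_le_one_right (Real.exp_pos _).le (hup t ht)
    rw [integral_exp_mul_Ioi hneg] at key
    have h2 := mul_le_mul_of_nonneg_left key (mul_pos hx (Real.exp_pos x)).le
    refine le_trans h2 (le_of_eq ?_)
    rw [neg_div_neg_eq, mul_one, Real.exp_neg]
    field_simp
end

section
/- Let θ > 0 and ν > 0. Then lim_{γ→∞} e^{θγ + ν} · θ · ∫_γ^∞ exp(−θx − νγ/x) dx = 1. Equivalently, writing F_{θ,ν}(γ) = 1 − θ ∫_γ^∞ exp(−θx − νγ/x) dx for γ > 0, the tail satisfies 1 − F_{θ,ν}(γ) ~ exp(−θγ − ν) as γ → ∞. -/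
open MeasureTheory Filter Real Asymptotics

theorem tail_aux (θ ν : ℝ) (hθ : 0 < θ) (hν : 0 < ν) :
    Tendsto
      (fun γ : ℝ =>
        Real.exp (θ * γ + ν) * (θ * ∫ x in Set.Ioi γ, Real.exp (-θ * x - ν * γ / x)))
      atTop (nhds 1) := by
  have hint : IntegrableOn (fun t : ℝ => Real.exp (-θ * t)) (Set.Ioi 0) :=
    integrableOn_exp_mul_Ioi (by linarith) 0
  have hval : ∫ t in Set.Ioi (0:ℝ), θ * Real.exp (-θ * t) = 1 := by
    rw [integral_const_mul, integral_exp_mul_Ioi (by linarith)]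
    simp
    field_simp
  have hshift : ∀ γ : ℝ,
      Real.exp (θ * γ + ν) * (θ * ∫ x in Set.Ioi γ, Real.exp (-θ * x - ν * γ / x))
      = ∫ t in Set.Ioi (0:ℝ), θ * Real.exp (-θ * t + (ν - ν * γ / (t + γ))) := by
    intro γ
    have h := (measurePreserving_add_right (volume : Measure ℝ) γ).setIntegral_preimage_emb
      (measurableEmbedding_addRight γ) (fun x => Real.exp (-θ * x - ν * γ / x)) (Set.Ioi γ)
    have hs : (fun x : ℝ => x + γ) ⁻¹' Set.Ioi γ = Set.Ioi 0 := by
      ext x; simp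
    rw [hs] at h
    rw [← h, ← integral_const_mul, ← integral_const_mul]
    congr 1
    ext t
    rw [mul_left_comm, ← Real.exp_add]
    congr 2
    ring
  simp_rw [hshift]
  rw [← hval]
  refine tendsto_integral_filter_of_dominated_convergence
    (fun t => θ * Real.exp ν * Real.exp (-θ * t)) ?_ ?_ ?_ ?_
  · refine Eventually.of_forall fun γ => ?_
    exact Measurable.aestronglyMeasurable (by fun_prop)
  · filter_upwards [eventually_gt_atTop (0:ℝ)] with γ hγ
    filter_upwards [ae_restrict_mem measurableSet_Ioi] with t ht
    have ht : 0 < t := ht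
    rw [Real.norm_of_nonneg (by positivity), mul_assoc, ← Real.exp_add]
    have : 0 ≤ ν * γ / (t + γ) := by positivity
    exact mul_le_mul_of_nonneg_left (Real.exp_le_exp.2 (by linarith)) hθ.le
  · exact hint.const_mul _
  · filter_upwards with t
    have h1 : Tendsto (fun γ : ℝ => ν * t / (t + γ)) atTop (nhds 0) :=
      tendsto_const_nhds.div_atTop (tendsto_atTop_add_const_left _ _ tendsto_id)
    have h2 : Tendsto (fun γ : ℝ => ν - ν * γ / (t + γ)) atTop (nhds 0) := by
      refine h1.congr' ?_
      filter_upwards [eventually_gt_atTop (-t)] with γ hγ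
      have : t + γ ≠ 0 := ne_of_gt (by linarith)
      field_simp
      ring
    have h3 := ((Real.continuous_exp.tendsto _).comp (h2.const_add (-θ * t))).const_mul θ
    simpa using h3



/-- **Exponential tail equivalence of the single-link e2e SNR CDF.** For `θ, ν > 0`,
`e^{θγ + ν} · θ ∫_γ^∞ exp(-θ x - ν γ / x) dx → 1` as `γ → ∞`; i.e. writing
`F_{θ,ν}(γ) = 1 - θ ∫_γ^∞ exp(-θ x - ν γ / x) dx`, the tail satisfies
`1 - F_{θ,ν}(γ) ~ exp(-θ γ - ν)` as `γ → ∞`. -/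
theorem tail_equiv_exp (θ ν : ℝ) (hθ : 0 < θ) (hν : 0 < ν) :
    Tendsto
      (fun γ : ℝ =>
        Real.exp (θ * γ + ν) * (θ * ∫ x in Set.Ioi γ, Real.exp (-θ * x - ν * γ / x)))
      atTop (nhds 1) ∧
    (fun γ : ℝ => 1 - (1 - θ * ∫ x in Set.Ioi γ, Real.exp (-θ * x - ν * γ / x))) ~[atTop]
      (fun γ : ℝ => Real.exp (-θ * γ - ν)) := by
  have h := tail_aux θ ν hθ hν
  refine ⟨h, ?_⟩
  refine (isEquivalent_iff_tendsto_one ?_).2 ?_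
  · exact Eventually.of_forall fun γ => Real.exp_ne_zero _
  · refine h.congr fun γ => ?_
    have e : -θ * γ - ν = -(θ * γ + ν) := by ring
    simp only [Pi.div_apply, sub_sub_cancel]
    rw [e, Real.exp_neg, div_inv_eq_mul, mul_comm]
end

section
/- Let θ > 0 and ν > 0, and let F_{θ,ν}(γ) = 1 − θ ∫_γ^∞ exp(−θx − νγ/x) dx for γ > 0 (and F_{θ,ν}(γ) = 0 for γ ≤ 0). Define the normalising constants a_L = 1/θ and b_L = (log L − ν)/θ. Then for every γ ∈ ℝ, lim_{L→∞} (F_{θ,ν}(a_L γ + b_L))^L = exp(−exp(−γ)). In other words, when all L relay links are i.i.d., the distribution function of the normalised maximum end-to-end SNR (max_{ℓ≤L} γ_{e2e,ℓ} − b_L)/a_L converges pointwise to the standard Gumbel distribution. -/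
open MeasureTheory Filter Real

/-- The CDF `F_{θ,ν}` of the end-to-end SNR `min(X, X·Y)` of a single decode-and-forward
relay link with `X ~ Exp(θ)`, `Y ~ Exp(ν)` independent:
`F_{θ,ν}(γ) = 1 - θ ∫_γ^∞ exp(-θ x - ν γ / x) dx` for `γ > 0`, and `0` otherwise. -/
noncomputable def e2eCDF (θ ν γ : ℝ) : ℝ :=
  if 0 < γ then 1 - θ * ∫ x in Set.Ioi γ, Real.exp (-θ * x - ν * γ / x) else 0

lemma e2e_integrable (θ ν g : ℝ) (hθ : 0 < θ) (hν : 0 < ν) (hg : 0 < g) :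
    IntegrableOn (fun x : ℝ => Real.exp (-θ * x - ν * g / x)) (Set.Ioi g) := by
  refine Integrable.mono' (integrableOn_exp_mul_Ioi (a := -θ) (by linarith) g) ?_ ?_
  · exact Measurable.aestronglyMeasurable (by fun_prop)
  · refine (ae_restrict_iff' measurableSet_Ioi).2 (ae_of_all _ fun x hx => ?_)
    have hx0 : 0 < x := hg.trans hx
    rw [Real.norm_eq_abs, abs_of_pos (Real.exp_pos _)]
    apply Real.exp_le_exp.2
    have : 0 < ν * g / x := by positivity
    linarith

lemma e2e_lower (θ ν g : ℝ) (hθ : 0 < θ) (hν : 0 < ν) (hg : 0 < g) :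
    Real.exp (-θ * g - ν) / θ ≤ ∫ x in Set.Ioi g, Real.exp (-θ * x - ν * g / x) := by
  have h1 : ∫ x in Set.Ioi g, Real.exp (-ν) * Real.exp (-θ * x) = Real.exp (-θ * g - ν) / θ := by
    rw [integral_const_mul, integral_exp_mul_Ioi (by linarith), sub_eq_add_neg, Real.exp_add]
    field_simp
  rw [← h1]
  refine setIntegral_mono_on ((integrableOn_exp_mul_Ioi (a := -θ) (by linarith) g).const_mul _)
    (e2e_integrable θ ν g hθ hν hg) measurableSet_Ioi fun x hx => ?_
  have hx' : g < x := hx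
  have hx0 : 0 < x := hg.trans hx
  rw [← Real.exp_add]
  apply Real.exp_le_exp.2
  have : ν * g / x ≤ ν := by
    rw [div_le_iff₀ hx0]
    nlinarith
  linarith

lemma e2e_upper (θ ν g : ℝ) (hθ : 0 < θ) (hν : 0 < ν) (hg : 0 < g) (h : 0 < θ - ν / g) :
    ∫ x in Set.Ioi g, Real.exp (-θ * x - ν * g / x) ≤ Real.exp (-θ * g - ν) / (θ - ν / g) := by
  have ha : -(θ - ν / g) < 0 := by linarith
  have h1 : ∫ x in Set.Ioi g, Real.exp (-2 * ν) * Real.exp (-(θ - ν / g) * x)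
      = Real.exp (-θ * g - ν) / (θ - ν / g) := by
    rw [integral_const_mul, integral_exp_mul_Ioi ha, neg_div_neg_eq, ← mul_div_assoc,
      ← Real.exp_add]
    congr 2
    field_simp
    ring
  rw [← h1]
  refine setIntegral_mono_on (e2e_integrable θ ν g hθ hν hg)
    ((integrableOn_exp_mul_Ioi ha g).const_mul _) measurableSet_Ioi fun x hx => ?_
  have hx0 : 0 < x := hg.trans hx
  rw [← Real.exp_add]
  apply Real.exp_le_exp.2
  have : 0 ≤ ν * (x - g) ^ 2 / (g * x) := by positivity
  have e : ν * (x - g) ^ 2 / (g * x) = ν / g * x - 2 * ν + ν * g / x := by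
    field_simp
    ring
  linarith

theorem gumbel_limit_iid (θ ν : ℝ) (hθ : 0 < θ) (hν : 0 < ν) (γ : ℝ) :
    Tendsto
      (fun L : ℕ => (e2eCDF θ ν ((1 / θ) * γ + (Real.log L - ν) / θ)) ^ L)
      atTop (nhds (Real.exp (-Real.exp (-γ)))) := by
  have hg : Tendsto (fun L : ℕ => (1 / θ) * γ + (Real.log L - ν) / θ) atTop atTop := by
    apply tendsto_atTop_add_const_left
    apply Tendsto.atTop_div_const hθ
    simp only [sub_eq_add_neg]
    apply tendsto_atTop_add_const_right
    exact Real.tendsto_log_atTop.comp tendsto_natCast_atTop_atTop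
  have hd : Tendsto (fun L : ℕ => θ - ν / ((1 / θ) * γ + (Real.log L - ν) / θ)) atTop
      (nhds θ) := by
    simpa using (tendsto_const_nhds (x := θ)).sub (hg.const_div_atTop ν)
  have hE : ∀ L : ℕ, 0 < L →
      L * Real.exp (-θ * ((1 / θ) * γ + (Real.log L - ν) / θ) - ν) = Real.exp (-γ) := by
    intro L hL
    have hL' : (0 : ℝ) < L := by exact_mod_cast hL
    have : -θ * ((1 / θ) * γ + (Real.log L - ν) / θ) - ν = -γ - Real.log L := by
      field_simp
      ring
    rw [this, Real.exp_sub, Real.exp_log hL']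
    field_simp
  have key : Tendsto (fun L : ℕ => (L : ℝ) *
      (1 - e2eCDF θ ν ((1 / θ) * γ + (Real.log L - ν) / θ))) atTop (nhds (Real.exp (-γ))) := by
    have hu : Tendsto (fun L : ℕ => Real.exp (-γ) *
        (θ / (θ - ν / ((1 / θ) * γ + (Real.log L - ν) / θ)))) atTop (nhds (Real.exp (-γ))) := by
      simpa [hθ.ne'] using
        (tendsto_const_nhds (x := Real.exp (-γ))).mul ((tendsto_const_nhds (x := θ)).div hd hθ.ne')
    refine tendsto_of_tendsto_of_tendsto_of_le_of_le' tendsto_const_nhds hu ?_ ?_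
    · filter_upwards [hg.eventually_gt_atTop 0, eventually_gt_atTop 0] with L h1 h2
      have hl := e2e_lower θ ν _ hθ hν h1
      rw [← hE L h2, e2eCDF, if_pos h1, sub_sub_cancel]
      rw [div_le_iff₀' hθ] at hl
      gcongr
    · filter_upwards [hg.eventually_gt_atTop 0, eventually_gt_atTop 0,
        hd.eventually_const_lt hθ] with L h1 h2 h3
      have hl := mul_le_mul_of_nonneg_left (e2e_upper θ ν _ hθ hν h1 h3) hθ.le
      have hl2 := mul_le_mul_of_nonneg_left hl (Nat.cast_nonneg (α := ℝ) L)
      rw [← hE L h2, e2eCDF, if_pos h1, sub_sub_cancel]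
      refine hl2.trans (le_of_eq ?_)
      ring
  have := Real.tendsto_one_add_pow_exp_of_tendsto
    (g := fun L : ℕ => -(1 - e2eCDF θ ν ((1 / θ) * γ + (Real.log L - ν) / θ)))
    (t := -Real.exp (-γ)) (by simpa only [mul_neg] using key.neg)
  refine this.congr fun L => ?_
  congr 1
  ring
end

section
/- Let θ > 0, and let ν : ℕ → ℝ be a bounded sequence, say m ≤ ν_ℓ ≤ M for all ℓ. For γ > 0 set F_ℓ(γ) = 1 − θ ∫_γ^∞ exp(−θx − ν_ℓ γ/x) dx (and F_ℓ(γ) = 0 for γ ≤ 0). Define S_L = Σ_{ℓ=1}^L exp(−ν_ℓ), a_L = 1/θ and b_L = (1/θ) log S_L. Then for every γ ∈ ℝ, lim_{L→∞} Π_{ℓ=1}^L F_ℓ(a_L γ + b_L) = exp(−exp(−γ)). -/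
open MeasureTheory Filter Real Finset

lemma gl_exp_diff {a b K : ℝ} (ha : a ≤ K) (hb : b ≤ K) :
    |Real.exp a - Real.exp b| ≤ Real.exp K * |a - b| := by
  have key : ∀ a b : ℝ, a ≤ K → Real.exp a - Real.exp b ≤ Real.exp K * |a - b| := by
    intro a b ha
    have h1 : Real.exp b = Real.exp a * Real.exp (b - a) := by
      rw [← Real.exp_add]; congr 1; ring
    have h2 := Real.add_one_le_exp (b - a)
    have h3 : Real.exp a - Real.exp b ≤ Real.exp a * (a - b) := by
      rw [h1]; nlinarith [Real.exp_pos a]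
    have h4 : Real.exp a * (a - b) ≤ Real.exp a * |a - b| :=
      mul_le_mul_of_nonneg_left (le_abs_self _) (Real.exp_pos a).le
    have h5 : Real.exp a * |a - b| ≤ Real.exp K * |a - b| :=
      mul_le_mul_of_nonneg_right (Real.exp_le_exp.2 ha) (abs_nonneg _)
    linarith
  rw [abs_le]
  constructor
  · have := key b a hb
    rw [abs_sub_comm] at this
    linarith
  · exact key a b ha

lemma gl_moment (θ g : ℝ) (hθ : 0 < θ) :
    IntegrableOn (fun x => Real.exp (-θ * x) * (x - g)) (Set.Ioi g) ∧
    ∫ x in Set.Ioi g, Real.exp (-θ * x) * (x - g) = Real.exp (-θ * g) / θ ^ 2 := by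
  have hd : ∀ x ∈ Set.Ici g, HasDerivAt
      (fun x => -(Real.exp (-θ * x) * ((x - g) / θ + 1 / θ ^ 2)))
      (Real.exp (-θ * x) * (x - g)) x := by
    intro x _
    have h1 : HasDerivAt (fun x : ℝ => Real.exp (-θ * x)) (Real.exp (-θ * x) * (-θ * 1)) x :=
      ((hasDerivAt_id x).const_mul (-θ)).exp
    have h2 : HasDerivAt (fun x : ℝ => (x - g) / θ + 1 / θ ^ 2) (1 / θ) x :=
      (((hasDerivAt_id x).sub_const g).div_const θ).add_const _
    refine (h1.mul h2).neg.congr_deriv ?_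
    field_simp
    ring
  have hE : Tendsto (fun x : ℝ => Real.exp (-θ * x)) atTop (nhds 0) := by
    have : Tendsto (fun x : ℝ => -θ * x) atTop atBot :=
      tendsto_id.const_mul_atTop_of_neg (by linarith)
    exact Real.tendsto_exp_atBot.comp this
  have hxE : Tendsto (fun x : ℝ => x * Real.exp (-θ * x)) atTop (nhds 0) := by
    have := tendsto_rpow_mul_exp_neg_mul_atTop_nhds_zero 1 θ hθ
    simpa using this
  have ht : Tendsto (fun x => -(Real.exp (-θ * x) * ((x - g) / θ + 1 / θ ^ 2))) atTop (nhds 0) := by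
    have := ((hxE.mul_const (1 / θ)).add (hE.mul_const (-g / θ + 1 / θ ^ 2))).neg
    simp only [zero_mul, add_zero, neg_zero] at this
    refine this.congr ?_
    intro x
    ring
  have hpos : ∀ x ∈ Set.Ioi g, 0 ≤ Real.exp (-θ * x) * (x - g) := by
    intro x hx
    have : g < x := hx
    exact mul_nonneg (Real.exp_pos _).le (by linarith)
  refine ⟨integrableOn_Ioi_deriv_of_nonneg' hd hpos ht, ?_⟩
  rw [integral_Ioi_of_hasDerivAt_of_nonneg' hd hpos ht]
  ring

lemma gl_main (θ g ν K : ℝ) (hθ : 0 < θ) (hg : 0 < g) (hK : |ν| ≤ K) :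
    |θ * (∫ x in Set.Ioi g, Real.exp (-θ * x - ν * g / x)) - Real.exp (-θ * g) * Real.exp (-ν)|
      ≤ Real.exp (-θ * g) * (Real.exp K * K / (θ * g)) := by
  have hK0 : 0 ≤ K := (abs_nonneg _).trans hK
  obtain ⟨hi, hv⟩ := gl_moment θ g hθ
  have hiE : IntegrableOn (fun x => Real.exp (-θ * x)) (Set.Ioi g) := exp_neg_integrableOn_Ioi g hθ
  have hvE : ∫ x in Set.Ioi g, Real.exp (-θ * x) = Real.exp (-θ * g) / θ := by
    rw [integral_exp_mul_Ioi (by linarith)]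
    field_simp
  have hbd : ∀ x ∈ Set.Ioi g, ‖Real.exp (-θ * x - ν * g / x) - Real.exp (-θ * x) * Real.exp (-ν)‖
      ≤ Real.exp K * K / g * (Real.exp (-θ * x) * (x - g)) := by
    intro x hx
    have hx : g < x := hx
    have hx0 : 0 < x := hg.trans hx
    have h1 : Real.exp (-θ * x - ν * g / x) - Real.exp (-θ * x) * Real.exp (-ν)
        = Real.exp (-θ * x) * (Real.exp (-(ν * (g / x))) - Real.exp (-ν)) := by
      rw [show -θ * x - ν * g / x = -θ * x + -(ν * (g / x)) by ring, Real.exp_add]; ring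
    have hr1 : g / x ≤ 1 := (div_le_one hx0).2 hx.le
    have hr0 : 0 < g / x := div_pos hg hx0
    obtain ⟨hl, hu⟩ := abs_le.1 hK
    have ha : -(ν * (g / x)) ≤ K := by nlinarith
    have h2 := gl_exp_diff ha (show -ν ≤ K by linarith)
    have h3 : |-(ν * (g / x)) - -ν| ≤ K * ((x - g) / g) := by
      have : -(ν * (g / x)) - -ν = ν * ((x - g) / x) := by field_simp; ring
      rw [this, abs_mul, abs_of_nonneg (div_nonneg (by linarith) hx0.le : 0 ≤ (x - g) / x)]
      have : (x - g) / x ≤ (x - g) / g :=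
        div_le_div_of_nonneg_left (by linarith) hg hx.le
      exact mul_le_mul hK this (div_nonneg (by linarith) hx0.le) hK0
    rw [h1, norm_mul, Real.norm_eq_abs, Real.norm_eq_abs, abs_of_pos (Real.exp_pos _)]
    calc _ ≤ Real.exp (-θ * x) * (Real.exp K * (K * ((x - g) / g))) := by gcongr; exact h2.trans (by gcongr)
      _ = _ := by ring
  have hib : IntegrableOn (fun x => Real.exp K * K / g * (Real.exp (-θ * x) * (x - g))) (Set.Ioi g) :=
    hi.const_mul _
  have hiE' : IntegrableOn (fun x => Real.exp (-θ * x) * Real.exp (-ν)) (Set.Ioi g) :=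
    hiE.mul_const _
  have hid : IntegrableOn (fun x => Real.exp (-θ * x - ν * g / x) -
      Real.exp (-θ * x) * Real.exp (-ν)) (Set.Ioi g) := by
    refine Integrable.mono' hib ?_ ((ae_restrict_iff' measurableSet_Ioi).2 (ae_of_all _ hbd))
    exact Measurable.aestronglyMeasurable (by fun_prop)
  have hif : IntegrableOn (fun x => Real.exp (-θ * x - ν * g / x)) (Set.Ioi g) := by
    have := hid.add hiE'
    refine this.congr (ae_of_all _ ?_)
    intro x; simp
  have hle := norm_integral_le_of_norm_le hib
    ((ae_restrict_iff' measurableSet_Ioi).2 (ae_of_all _ hbd))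
  rw [integral_sub hif hiE', integral_const_mul, hv, integral_mul_const, hvE, Real.norm_eq_abs] at hle
  have : θ * (∫ x in Set.Ioi g, Real.exp (-θ * x - ν * g / x)) - Real.exp (-θ * g) * Real.exp (-ν)
      = θ * ((∫ x in Set.Ioi g, Real.exp (-θ * x - ν * g / x))
        - Real.exp (-θ * g) / θ * Real.exp (-ν)) := by field_simp
  rw [this, abs_mul, abs_of_pos hθ]
  calc _ ≤ θ * _ := mul_le_mul_of_nonneg_left hle hθ.le
    _ = _ := by field_simp

lemma gl_prod (D : ℕ → ℕ → ℝ) (ε : ℕ → ℝ) (c : ℝ) (hε : Tendsto ε atTop (nhds 0))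
    (hD : ∀ᶠ L in atTop, ∀ l, 0 ≤ D L l ∧ D L l ≤ ε L)
    (hs : Tendsto (fun L => ∑ l ∈ Finset.range L, D L l) atTop (nhds c)) :
    Tendsto (fun L => ∏ l ∈ Finset.range L, (1 - D L l)) atTop (nhds (Real.exp (-c))) := by
  have hlow : Tendsto (fun L => Real.exp (-((1 + 2 * ε L) * ∑ l ∈ Finset.range L, D L l)))
      atTop (nhds (Real.exp (-c))) := by
    have := (((hε.const_mul 2).const_add 1).mul hs).neg
    simp only [mul_zero, add_zero, one_mul] at this
    exact (Real.continuous_exp.tendsto _).comp this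
  have hup : Tendsto (fun L => Real.exp (-(∑ l ∈ Finset.range L, D L l)))
      atTop (nhds (Real.exp (-c))) := (Real.continuous_exp.tendsto _).comp hs.neg
  have he : ∀ᶠ L in atTop, ε L < 1 / 2 := hε.eventually (gt_mem_nhds (by norm_num))
  refine tendsto_of_tendsto_of_tendsto_of_le_of_le' hlow hup ?_ ?_
  · filter_upwards [hD, he] with L h1 h2
    rw [Finset.mul_sum, ← Finset.sum_neg_distrib, Real.exp_sum]
    refine Finset.prod_le_prod (fun _ _ => (Real.exp_pos _).le) (fun l _ => ?_)
    obtain ⟨h0, h3⟩ := h1 l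
    have hp : 0 < 1 - D L l := by linarith
    rw [← Real.le_log_iff_exp_le hp]
    have h4 := Real.one_sub_inv_le_log_of_pos hp
    have h5 : (1 - D L l)⁻¹ ≤ 1 + (1 + 2 * ε L) * D L l := by
      rw [inv_le_iff_one_le_mul₀ hp]
      nlinarith [mul_nonneg h0 h0, mul_nonneg h0 (sub_nonneg.2 h3), mul_nonneg (mul_nonneg h0 (sub_nonneg.2 h3)) hp.le,
        mul_nonneg (mul_nonneg h0 h0) (by linarith : 0 ≤ 1 - 2 * D L l)]
    linarith
  · filter_upwards [hD, he] with L h1 h2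
    rw [← Finset.sum_neg_distrib, Real.exp_sum]
    refine Finset.prod_le_prod (fun l _ => ?_) (fun l _ => ?_)
    · linarith [(h1 l).2]
    · linarith [Real.add_one_le_exp (-D L l)]

/-- **Gumbel limit when the source-to-relay links are i.i.d.** Let `θ > 0` be the common
first-hop rate and `ν ℓ` a bounded sequence of second-hop parameters. With
`S_L = ∑_{ℓ<L} exp(-ν ℓ)`, `a_L = 1/θ` and `b_L = (1/θ) log S_L`, for every `γ ∈ ℝ` the
CDF of the normalised maximum, `∏_{ℓ<L} F_ℓ(a_L γ + b_L)`, converges to `exp(-exp(-γ))`. -/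
theorem gumbel_limit_iid_first_hop (θ : ℝ) (hθ : 0 < θ) (ν : ℕ → ℝ) (m M : ℝ)
    (hν : ∀ ℓ, m ≤ ν ℓ ∧ ν ℓ ≤ M) (γ : ℝ) :
    Tendsto
      (fun L : ℕ =>
        ∏ ℓ ∈ Finset.range L,
          e2eCDF θ (ν ℓ)
            ((1 / θ) * γ + (1 / θ) * Real.log (∑ j ∈ Finset.range L, Real.exp (-ν j))))
      atTop (nhds (Real.exp (-Real.exp (-γ)))) := by
  set S : ℕ → ℝ := fun L => ∑ j ∈ Finset.range L, Real.exp (-ν j) with hS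
  set g : ℕ → ℝ := fun L => (1 / θ) * γ + (1 / θ) * Real.log (S L) with hg
  set K : ℝ := max |m| |M| with hKdef
  have hK : ∀ l, |ν l| ≤ K := fun l => abs_le_max_abs_abs (hν l).1 (hν l).2
  have hK0 : 0 ≤ K := (abs_nonneg _).trans (hK 0)
  have hSL : ∀ L : ℕ, (L : ℝ) * Real.exp (-M) ≤ S L := by
    intro L
    have : ∑ j ∈ Finset.range L, Real.exp (-M) ≤ S L :=
      Finset.sum_le_sum (fun j _ => Real.exp_le_exp.2 (by linarith [(hν j).2]))
    simpa using this
  have hSt : Tendsto S atTop atTop :=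
    tendsto_atTop_mono hSL (tendsto_natCast_atTop_atTop.atTop_mul_const (Real.exp_pos _))
  have hgt : Tendsto g atTop atTop :=
    tendsto_atTop_add_const_left _ _
      ((Real.tendsto_log_atTop.comp hSt).const_mul_atTop (by positivity))
  have hS0 : ∀ᶠ L in atTop, 0 < S L := hSt.eventually_gt_atTop 0
  have hg0 : ∀ᶠ L in atTop, 1 < g L := hgt.eventually_gt_atTop 1
  have hexp : ∀ L, 0 < S L → Real.exp (-θ * g L) = Real.exp (-γ) / S L := by
    intro L h
    have : -θ * g L = -γ - Real.log (S L) := by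
      simp only [hg]; field_simp; ring
    rw [this, Real.exp_sub, Real.exp_log h]
  set D : ℕ → ℕ → ℝ := fun L l =>
    θ * ∫ x in Set.Ioi (g L), Real.exp (-θ * x - ν l * g L / x) with hDdef
  set B : ℝ := Real.exp K * K / θ with hB
  have hB0 : 0 ≤ B := by positivity
  have hbd : ∀ L, 0 < S L → 0 < g L → ∀ l,
      |D L l - Real.exp (-γ) / S L * Real.exp (-ν l)| ≤ Real.exp (-γ) / S L * (B / g L) := by
    intro L h1 h2 l
    have := gl_main θ (g L) (ν l) K hθ h2 (hK l)
    rw [hexp L h1] at this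
    rw [hB, div_div]
    exact this
  have hprod := gl_prod D (fun L => Real.exp (-γ) * (Real.exp K + B) / S L) (Real.exp (-γ))
    (hSt.const_div_atTop _) ?_ ?_
  · refine hprod.congr' ?_
    filter_upwards [hg0] with L h
    refine Finset.prod_congr rfl (fun l _ => ?_)
    simp only [e2eCDF, hDdef]
    rw [if_pos (by linarith : 0 < g L)]
  · filter_upwards [hS0, hg0] with L h1 h2 l
    constructor
    · exact mul_nonneg hθ.le (integral_nonneg (fun x => (Real.exp_pos _).le))
    · have h3 := (abs_le.1 (hbd L h1 (by linarith) l)).2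
      have h4 : B / g L ≤ B := div_le_self hB0 h2.le
      have h5 : Real.exp (-ν l) ≤ Real.exp K :=
        Real.exp_le_exp.2 (by linarith [(abs_le.1 (hK l)).1])
      have h6 : 0 < Real.exp (-γ) / S L := by positivity
      calc D L l ≤ Real.exp (-γ) / S L * (Real.exp (-ν l) + B / g L) := by linarith
        _ ≤ Real.exp (-γ) / S L * (Real.exp K + B) := by gcongr
        _ = _ := by ring
  · rw [tendsto_iff_norm_sub_tendsto_zero]
    have hz : Tendsto (fun L => Real.exp (-γ) * Real.exp M * B / g L) atTop (nhds 0) :=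
      hgt.const_div_atTop _
    refine squeeze_zero' (Eventually.of_forall fun _ => norm_nonneg _) ?_ hz
    filter_upwards [hS0, hg0] with L h1 h2
    have h3 : ∑ l ∈ Finset.range L, D L l - Real.exp (-γ)
        = ∑ l ∈ Finset.range L, (D L l - Real.exp (-γ) / S L * Real.exp (-ν l)) := by
      rw [Finset.sum_sub_distrib]
      congr 1
      rw [← Finset.mul_sum]
      change _ = Real.exp (-γ) / S L * S L
      field_simp
    rw [h3]
    refine (norm_sum_le_of_le _ (fun l _ => hbd L h1 (by linarith) l)).trans ?_
    rw [Finset.sum_const, Finset.card_range, nsmul_eq_mul]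
    have h4 : (L : ℝ) / S L ≤ Real.exp M := by
      rw [div_le_iff₀ h1]
      have := mul_le_mul_of_nonneg_left (hSL L) (Real.exp_pos M).le
      rw [mul_left_comm, ← Real.exp_add] at this
      simpa using this
    have h5 : 0 ≤ B / g L := div_nonneg hB0 (by linarith)
    calc _ = Real.exp (-γ) * ((L : ℝ) / S L) * (B / g L) := by ring
      _ ≤ Real.exp (-γ) * Real.exp M * (B / g L) := by gcongr
      _ = _ := by ring
end

section
/- Let Θ = {t_1, t_2, …, t_R} be a finite set of positive reals, let β ∈ Θ, and let θ : ℕ → Θ be a sequence. For each i and each L let R_i(L) = #{ℓ ∈ {1,…,L} : θ_ℓ = t_i}, and write R_β(L) for the count corresponding to the value β. Assume (i) R_β(L) → ∞ as L → ∞; (ii) for every t_i ∈ Θ with t_i > β, R_i(L) · (R_β(L))^{−t_i/β} → 0 as L → ∞; and (iii) for every t_i ∈ Θ with t_i < β, the sequence R_i(L) is bounded. Then for every γ ∈ ℝ, lim_{L→∞} Σ_{ℓ=1}^L exp(−θ_ℓ · (γ + log R_β(L)) / β) = exp(−γ). -/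
open MeasureTheory Filter Real Finset
open scoped Classical

/-- `Rcount θ t L` is the number of indices `ℓ` among the first `L` links whose first-hop
parameter `θ ℓ` equals `t`. -/
noncomputable def Rcount (θ : ℕ → ℝ) (t : ℝ) (L : ℕ) : ℕ :=
  ((Finset.range L).filter fun ℓ => θ ℓ = t).card

/-- **Evaluation of the limit `ũ(γ)` when the relay-to-destination links are i.i.d.**
The first-hop parameters `θ ℓ` take values in a finite set `Θ` of positive reals, and
`β ∈ Θ` satisfies: (i) its count tends to infinity; (ii) for `t ∈ Θ` with `t > β`,
`R_t(L) · R_β(L)^{-t/β} → 0`; (iii) for `t ∈ Θ` with `t < β`, `R_t(L)` is bounded.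
Then `∑_{ℓ<L} exp(-θ ℓ (γ + log R_β(L)) / β) → exp(-γ)` for every `γ`. -/
theorem u_limit_iid_second_hop (Θ : Finset ℝ) (hΘpos : ∀ t ∈ Θ, 0 < t)
    (β : ℝ) (hβ : β ∈ Θ) (θ : ℕ → ℝ) (hθ : ∀ ℓ, θ ℓ ∈ Θ)
    (h1 : Tendsto (fun L : ℕ => (Rcount θ β L : ℝ)) atTop atTop)
    (h2 : ∀ t ∈ Θ, β < t →
      Tendsto (fun L : ℕ => (Rcount θ t L : ℝ) * (Rcount θ β L : ℝ) ^ (-(t / β)))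
        atTop (nhds 0))
    (h3 : ∀ t ∈ Θ, t < β → ∃ C : ℝ, ∀ L : ℕ, (Rcount θ t L : ℝ) ≤ C) :
    ∀ γ : ℝ,
      Tendsto
        (fun L : ℕ =>
          ∑ ℓ ∈ Finset.range L,
            Real.exp (-θ ℓ * (γ + Real.log (Rcount θ β L)) / β))
        atTop (nhds (Real.exp (-γ))) := by
  intro γ
  have hβ0 : 0 < β := hΘpos β hβ
  have hpos : ∀ᶠ L : ℕ in atTop, (0 : ℝ) < (Rcount θ β L : ℝ) := h1.eventually_gt_atTop 0
  -- group the sum by the value of `θ`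
  have key : ∀ L : ℕ, ∑ ℓ ∈ Finset.range L,
      Real.exp (-θ ℓ * (γ + Real.log (Rcount θ β L)) / β)
      = ∑ t ∈ Θ, (Rcount θ t L : ℝ) * Real.exp (-t * (γ + Real.log (Rcount θ β L)) / β) := by
    intro L
    rw [← Finset.sum_fiberwise_of_maps_to (s := Finset.range L) (t := Θ) (g := θ)
      (fun ℓ _ => hθ ℓ)]
    refine Finset.sum_congr rfl fun t _ => ?_
    rw [Finset.sum_congr rfl (g := fun _ =>
      Real.exp (-t * (γ + Real.log (Rcount θ β L)) / β))]
    · rw [Finset.sum_const, nsmul_eq_mul]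
      simp only [Rcount]
    · intro ℓ hℓ
      rw [(Finset.mem_filter.mp hℓ).2]
  have split : ∀ t : ℝ, ∀ᶠ L : ℕ in atTop,
      Real.exp (-(t * γ / β)) * ((Rcount θ t L : ℝ) * (Rcount θ β L : ℝ) ^ (-(t / β)))
      = (Rcount θ t L : ℝ) * Real.exp (-t * (γ + Real.log (Rcount θ β L)) / β) := by
    intro t
    filter_upwards [hpos] with L hL
    rw [Real.rpow_def_of_pos hL, mul_left_comm, ← Real.exp_add]
    congr 2
    ring
  have term : ∀ t ∈ Θ, Tendsto (fun L : ℕ =>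
      (Rcount θ t L : ℝ) * Real.exp (-t * (γ + Real.log (Rcount θ β L)) / β)) atTop
      (nhds (if t = β then Real.exp (-γ) else 0)) := by
    intro t ht
    refine Tendsto.congr' (split t) ?_
    rcases lt_trichotomy t β with h | h | h
    · obtain ⟨C, hC⟩ := h3 t ht h
      rw [if_neg h.ne]
      have hz : Tendsto (fun L : ℕ => (Rcount θ β L : ℝ) ^ (-(t / β))) atTop (nhds 0) :=
        (tendsto_rpow_neg_atTop (div_pos (hΘpos t ht) hβ0)).comp h1
      have hb : Tendsto (fun L : ℕ => (Rcount θ t L : ℝ) * (Rcount θ β L : ℝ) ^ (-(t / β)))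
          atTop (nhds 0) := by
        refine squeeze_zero (fun L => by positivity) (fun L => ?_)
          (by simpa using hz.const_mul C)
        exact mul_le_mul_of_nonneg_right (hC L) (by positivity)
      simpa using hb.const_mul (Real.exp (-(t * γ / β)))
    · subst h
      rw [if_pos rfl]
      refine Tendsto.congr' ?_ tendsto_const_nhds
      filter_upwards [hpos] with L hL
      rw [div_self hβ0.ne', Real.rpow_neg_one, mul_inv_cancel₀ hL.ne', mul_one,
        mul_div_cancel_left₀ _ hβ0.ne']
    · rw [if_neg h.ne']
      simpa using (h2 t ht h).const_mul (Real.exp (-(t * γ / β)))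
  simp_rw [key]
  have := tendsto_finsetSum Θ term
  rwa [Finset.sum_ite_eq' Θ β, if_pos hβ] at this
end

section
/- Let Θ = {t_1, …, t_R} be a finite set of positive reals, β ∈ Θ, θ : ℕ → Θ a sequence, and ν : ℕ → ℝ a bounded sequence, say m ≤ ν_ℓ ≤ M for all ℓ. For each i let R_i(L) = #{ℓ ∈ {1,…,L} : θ_ℓ = t_i}, write R_β(L) for the count corresponding to β, and set S_L = Σ_{ℓ ≤ L, θ_ℓ = β} exp(−ν_ℓ). Assume (i) R_β(L) → ∞; (ii) for every t_i > β, R_i(L)·(R_β(L))^{−t_i/β} → 0; and (iii) for every t_i < β, R_i(L) is bounded. Then for every γ ∈ ℝ, lim_{L→∞} Σ_{ℓ=1}^L exp(−θ_ℓ · (γ + log S_L)/β − ν_ℓ) = exp(−γ). -/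
open MeasureTheory Filter Real Finset
open scoped Classical

/-- `Ssum θ ν β L = ∑_{ℓ < L, θ ℓ = β} exp (-ν ℓ)`. -/
noncomputable def Ssum (θ : ℕ → ℝ) (ν : ℕ → ℝ) (β : ℝ) (L : ℕ) : ℝ :=
  ∑ ℓ ∈ (Finset.range L).filter fun ℓ => θ ℓ = β, Real.exp (-ν ℓ)

/-- **Evaluation of the limit `ũ(γ)` in the fully i.n.i.d. case.** The first-hop
parameters `θ ℓ` take finitely many positive values in `Θ`, the second-hop parameters
`ν ℓ` are bounded, and `β ∈ Θ` satisfies: (i) its count tends to infinity; (ii) for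
`t ∈ Θ` with `t > β`, `R_t(L) · R_β(L)^{-t/β} → 0`; (iii) for `t ∈ Θ` with `t < β`,
`R_t(L)` is bounded.  With `S_L = ∑_{ℓ<L, θℓ=β} exp(-νℓ)`, then
`∑_{ℓ<L} exp(-θ ℓ (γ + log S_L)/β - ν ℓ) → exp(-γ)` for every `γ`. -/
theorem u_limit_inid (Θ : Finset ℝ) (hΘpos : ∀ t ∈ Θ, 0 < t)
    (β : ℝ) (hβ : β ∈ Θ) (θ : ℕ → ℝ) (hθ : ∀ ℓ, θ ℓ ∈ Θ)
    (ν : ℕ → ℝ) (m M : ℝ) (hν : ∀ ℓ, m ≤ ν ℓ ∧ ν ℓ ≤ M)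
    (h1 : Tendsto (fun L : ℕ => (Rcount θ β L : ℝ)) atTop atTop)
    (h2 : ∀ t ∈ Θ, β < t →
      Tendsto (fun L : ℕ => (Rcount θ t L : ℝ) * (Rcount θ β L : ℝ) ^ (-(t / β)))
        atTop (nhds 0))
    (h3 : ∀ t ∈ Θ, t < β → ∃ C : ℝ, ∀ L : ℕ, (Rcount θ t L : ℝ) ≤ C) :
    ∀ γ : ℝ,
      Tendsto
        (fun L : ℕ =>
          ∑ ℓ ∈ Finset.range L,
            Real.exp (-θ ℓ * (γ + Real.log (Ssum θ ν β L)) / β - ν ℓ))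
        atTop (nhds (Real.exp (-γ))) := by
  intro γ
  have hβ0 : 0 < β := hΘpos β hβ
  have hsplit : ∀ L : ℕ, (∑ ℓ ∈ Finset.range L,
      Real.exp (-θ ℓ * (γ + Real.log (Ssum θ ν β L)) / β - ν ℓ)) =
      ∑ t ∈ Θ, ∑ ℓ ∈ (Finset.range L).filter (fun ℓ => θ ℓ = t),
        Real.exp (-t * (γ + Real.log (Ssum θ ν β L)) / β - ν ℓ) := by
    intro L
    rw [← Finset.sum_fiberwise_of_maps_to (s := Finset.range L) (t := Θ) (g := θ)
      (fun ℓ _ => hθ ℓ)]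
    refine Finset.sum_congr rfl fun t _ => Finset.sum_congr rfl fun ℓ hℓ => ?_
    rw [(Finset.mem_filter.mp hℓ).2]
  have hlim : Real.exp (-γ) = ∑ t ∈ Θ, if t = β then Real.exp (-γ) else 0 := by
    rw [Finset.sum_ite_eq' Θ β, if_pos hβ]
  have hS : ∀ L : ℕ, (Rcount θ β L : ℝ) * Real.exp (-M) ≤ Ssum θ ν β L := by
    intro L
    unfold Rcount Ssum
    rw [← nsmul_eq_mul]
    refine Finset.card_nsmul_le_sum _ _ _ fun ℓ _ => ?_
    exact Real.exp_le_exp.mpr (neg_le_neg (hν ℓ).2)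
  have hz : ∀ t ∈ Θ, t ≠ β →
      Tendsto (fun L : ℕ => (Rcount θ t L : ℝ) * (Rcount θ β L : ℝ) ^ (-(t / β)))
        atTop (nhds 0) := by
    intro t ht hne
    rcases lt_or_gt_of_ne hne with h | h
    · obtain ⟨C, hC⟩ := h3 t ht h
      have hp : Tendsto (fun L : ℕ => (Rcount θ β L : ℝ) ^ (-(t / β))) atTop (nhds 0) :=
        (tendsto_rpow_neg_atTop (div_pos (hΘpos t ht) hβ0)).comp h1
      have hp2 := hp.const_mul C
      rw [mul_zero] at hp2
      refine squeeze_zero (fun L => by positivity) (fun L => ?_) hp2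
      exact mul_le_mul_of_nonneg_right (hC L) (by positivity)
    · exact h2 t ht h
  simp_rw [hsplit]
  rw [hlim]
  refine tendsto_finsetSum _ fun t ht => ?_
  have hpos : ∀ᶠ L : ℕ in atTop, 0 < (Rcount θ β L : ℝ) := h1.eventually_gt_atTop 0
  split_ifs with htβ
  · subst htβ
    refine tendsto_const_nhds.congr' ?_
    filter_upwards [hpos] with L hL
    have hSp : 0 < Ssum θ ν t L := lt_of_lt_of_le (by positivity) (hS L)
    have : ∀ ℓ, Real.exp (-t * (γ + Real.log (Ssum θ ν t L)) / t - ν ℓ) =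
        Real.exp (-γ) * (Ssum θ ν t L)⁻¹ * Real.exp (-ν ℓ) := by
      intro ℓ
      rw [← Real.exp_log (inv_pos.mpr hSp), Real.log_inv, ← Real.exp_add, ← Real.exp_add]
      congr 1
      field_simp
      ring
    simp_rw [this]
    rw [← Finset.mul_sum]
    change _ = _ * Ssum θ ν t L
    field_simp
  · have hk := (hz t ht htβ).const_mul (Real.exp (-m - t * γ / β + t * M / β))
    rw [mul_zero] at hk
    refine squeeze_zero' (Eventually.of_forall fun L => by positivity) ?_ hk
    filter_upwards [hpos] with L hL
    have hlog : Real.log (Rcount θ β L) - M ≤ Real.log (Ssum θ ν β L) := by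
      have := Real.log_le_log (by positivity) (hS L)
      rw [Real.log_mul hL.ne' (Real.exp_pos _).ne', Real.log_exp] at this
      linarith
    have htb : 0 < t / β := div_pos (hΘpos t ht) hβ0
    have hb : ∀ ℓ ∈ (Finset.range L).filter (fun ℓ => θ ℓ = t),
        Real.exp (-t * (γ + Real.log (Ssum θ ν β L)) / β - ν ℓ) ≤
        Real.exp (-m - t * γ / β + t * M / β) * (Rcount θ β L : ℝ) ^ (-(t / β)) := by
      intro ℓ _
      rw [Real.rpow_def_of_pos hL, ← Real.exp_add]
      apply Real.exp_le_exp.mpr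
      have e1 := mul_le_mul_of_nonneg_left hlog htb.le
      have e2 := (hν ℓ).1
      have e3 : -t * (γ + Real.log (Ssum θ ν β L)) / β =
        -(t * γ / β) - t / β * Real.log (Ssum θ ν β L) := by ring
      have e4 : t * M / β = t / β * M := by ring
      rw [e3, e4]
      linarith
    refine (Finset.sum_le_card_nsmul _ _ _ hb).trans (le_of_eq ?_)
    rw [nsmul_eq_mul]
    unfold Rcount
    ring
end

section
/- Let Θ = {t_1, …, t_R} be a finite set of positive reals, β ∈ Θ, θ : ℕ → Θ a sequence, and ν : ℕ → ℝ a bounded sequence, m ≤ ν_ℓ ≤ M. For γ > 0 set F_ℓ(γ) = 1 − θ_ℓ ∫_γ^∞ exp(−θ_ℓ x − ν_ℓ γ/x) dx (and F_ℓ(γ) = 0 for γ ≤ 0). Let R_i(L) = #{ℓ ≤ L : θ_ℓ = t_i}, let R_β(L) be the count for β, and S_L = Σ_{ℓ ≤ L, θ_ℓ = β} exp(−ν_ℓ). Assume (i) R_β(L) → ∞; (ii) for every t_i > β, R_i(L)·(R_β(L))^{−t_i/β} → 0; and (iii) for every t_i < β, R_i(L) is bounded. Then with a_L = 1/β and b_L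 = (1/β) log S_L, for every γ ∈ ℝ: lim_{L→∞} Π_{ℓ=1}^L F_ℓ(a_L γ + b_L) = exp(−exp(−γ)). That is, the normalised maximum end-to-end SNR over the L independent non-identically distributed relay links converges in distribution to the standard Gumbel distribution. -/
open MeasureTheory Filter Real Finset
open scoped Classical

lemma aux_int1 (t u : ℝ) (ht : 0 < t) :
    IntegrableOn (fun x => Real.exp (-t * x)) (Set.Ioi u) ∧
      ∫ x in Set.Ioi u, Real.exp (-t * x) = Real.exp (-t * u) / t := by
  refine ⟨integrableOn_exp_mul_Ioi (by linarith) u, ?_⟩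
  rw [integral_exp_mul_Ioi (by linarith) u, neg_div_neg_eq]

lemma aux_int2 (t u : ℝ) (ht : 0 < t) :
    IntegrableOn (fun x => (x - u) * Real.exp (-t * x)) (Set.Ioi u) ∧
      ∫ x in Set.Ioi u, (x - u) * Real.exp (-t * x) = Real.exp (-t * u) / t ^ 2 := by
  have hd : ∀ x ∈ Set.Ici u, HasDerivAt
      (fun x => -(((x - u) / t + 1 / t ^ 2) * Real.exp (-t * x)))
      ((x - u) * Real.exp (-t * x)) x := by
    intro x _
    have e1 : HasDerivAt (fun x : ℝ => (x - u) / t + 1 / t ^ 2) (1 / t) x :=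
      (((hasDerivAt_id x).sub_const u).div_const t).add_const _
    have e2 : HasDerivAt (fun x : ℝ => Real.exp (-t * x)) (Real.exp (-t * x) * (-t * 1)) x :=
      ((hasDerivAt_id x).const_mul (-t)).exp
    refine HasDerivAt.congr_deriv (e1.mul e2).neg ?_
    field_simp
    ring
  have hlim : Tendsto (fun x => -(((x - u) / t + 1 / t ^ 2) * Real.exp (-t * x))) atTop
      (nhds 0) := by
    have a1 : Tendsto (fun x : ℝ => x ^ 1 * Real.exp (-t * x)) atTop (nhds 0) := by
      have := tendsto_rpow_mul_exp_neg_mul_atTop_nhds_zero 1 t ht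
      simpa using this
    have a2 : Tendsto (fun x : ℝ => Real.exp (-t * x)) atTop (nhds 0) := by
      have := tendsto_rpow_mul_exp_neg_mul_atTop_nhds_zero 0 t ht
      simpa using this
    have := (a1.const_mul (1 / t)).add (a2.const_mul (-u / t + 1 / t ^ 2))
    have := this.neg
    simp only [mul_zero, add_zero, neg_zero] at this
    refine this.congr fun x => ?_
    ring
  have hn : ∀ x ∈ Set.Ioi u, 0 ≤ (x - u) * Real.exp (-t * x) := by
    intro x hx
    have : u < x := hx
    exact mul_nonneg (by linarith) (Real.exp_pos _).le
  refine ⟨integrableOn_Ioi_deriv_of_nonneg' hd hn hlim, ?_⟩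
  rw [integral_Ioi_of_hasDerivAt_of_nonneg' hd hn hlim]
  simp
  ring

/-- The tail function. -/
noncomputable def e2eTail (t v u : ℝ) : ℝ :=
  t * ∫ x in Set.Ioi u, Real.exp (-t * x - v * u / x)

lemma e2eTail_nonneg (t v u : ℝ) (ht : 0 < t) : 0 ≤ e2eTail t v u :=
  mul_nonneg ht.le (integral_nonneg fun _ => (Real.exp_pos _).le)

lemma abs_exp_sub_one_le' (s : ℝ) (K y : ℝ) (h : |s| ≤ K) (h' : |s| ≤ K * y) :
    |Real.exp s - 1| ≤ Real.exp K * (K * y) := by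
  have h0 : |Real.exp s - 1| ≤ Real.exp |s| * |s| := by
    rcases le_total 0 s with hs | hs
    · rw [abs_of_nonneg hs, abs_of_nonneg (by linarith [Real.add_one_le_exp s])]
      have := Real.add_one_le_exp (-s)
      have h3 : Real.exp s * Real.exp (-s) = 1 := by rw [← Real.exp_add]; simp
      nlinarith [Real.exp_pos s]
    · rw [abs_of_nonpos hs, abs_of_nonpos (by linarith [Real.exp_le_one_iff.2 hs])]
      have := Real.add_one_le_exp s
      have h3 := Real.one_le_exp (neg_nonneg.2 hs)
      nlinarith
  exact h0.trans (mul_le_mul (Real.exp_le_exp.2 h) h' (abs_nonneg _) (Real.exp_pos _).le)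

lemma e2eTail_approx (t v u K : ℝ) (ht : 0 < t) (hu : 0 < u) (hv : |v| ≤ K) :
    |e2eTail t v u - Real.exp (-t * u - v)| ≤
      Real.exp (-t * u - v) * (Real.exp K * K / (t * u)) := by
  have hK : 0 ≤ K := (abs_nonneg v).trans hv
  obtain ⟨i1, e1⟩ := aux_int1 t u ht
  obtain ⟨i2, e2⟩ := aux_int2 t u ht
  have hpt : ∀ x ∈ Set.Ioi u, 0 ≤ 1 - u / x ∧ 1 - u / x ≤ 1 ∧ 1 - u / x ≤ (x - u) / u := by
    intro x hx
    have hx : u < x := hx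
    have hx0 : 0 < x := hu.trans hx
    have q : 0 ≤ u / x := by positivity
    refine ⟨?_, by linarith, ?_⟩
    · rw [sub_nonneg, div_le_one hx0]; exact hx.le
    · rw [one_sub_div hx0.ne']
      exact div_le_div_of_nonneg_left (by linarith) hu hx.le
  have hsplit : ∀ x, Real.exp (-t * x - v * u / x) =
      Real.exp (-v) * Real.exp (-t * x) * Real.exp (v * (1 - u / x)) := by
    intro x
    rw [← Real.exp_add, ← Real.exp_add]
    congr 1; ring
  have hs : ∀ x ∈ Set.Ioi u, |v * (1 - u / x)| ≤ K ∧
      |v * (1 - u / x)| ≤ K * ((x - u) / u) := by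
    intro x hx
    obtain ⟨p1, p2, p3⟩ := hpt x hx
    rw [abs_mul, abs_of_nonneg p1]
    refine ⟨?_, mul_le_mul hv p3 p1 hK⟩
    nlinarith [abs_nonneg v]
  have hmeas : AEStronglyMeasurable (fun x => Real.exp (-t * x - v * u / x))
      (volume.restrict (Set.Ioi u)) := by
    apply Measurable.aestronglyMeasurable
    fun_prop
  have if1 : IntegrableOn (fun x => Real.exp (-t * x - v * u / x)) (Set.Ioi u) := by
    refine Integrable.mono' (i1.const_mul (Real.exp (-v) * Real.exp K)) hmeas ?_
    refine (ae_restrict_iff' measurableSet_Ioi).2 (ae_of_all _ fun x hx => ?_)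
    rw [Real.norm_eq_abs, abs_of_pos (Real.exp_pos _), hsplit]
    have := Real.exp_le_exp.2 ((le_abs_self _).trans (hs x hx).1)
    have := mul_le_mul_of_nonneg_left this
      (mul_pos (Real.exp_pos (-v)) (Real.exp_pos (-t * x))).le
    linarith
  have ih : IntegrableOn (fun x => Real.exp (-v) * Real.exp (-t * x)) (Set.Ioi u) :=
    i1.const_mul _
  have key : ‖∫ x in Set.Ioi u, (Real.exp (-t * x - v * u / x)
        - Real.exp (-v) * Real.exp (-t * x))‖ ≤
      ∫ x in Set.Ioi u, (Real.exp (-v) * (Real.exp K * K / u)) *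
        ((x - u) * Real.exp (-t * x)) := by
    refine norm_integral_le_of_norm_le (i2.const_mul _) ?_
    refine (ae_restrict_iff' measurableSet_Ioi).2 (ae_of_all _ fun x hx => ?_)
    have h1 : Real.exp (-t * x - v * u / x) - Real.exp (-v) * Real.exp (-t * x) =
      (Real.exp (-v) * Real.exp (-t * x)) * (Real.exp (v * (1 - u / x)) - 1) := by
      rw [hsplit]; ring
    have hp := mul_pos (Real.exp_pos (-v)) (Real.exp_pos (-t * x))
    rw [h1, Real.norm_eq_abs, abs_mul, abs_of_pos hp]
    have h2 := abs_exp_sub_one_le' _ K _ (hs x hx).1 (hs x hx).2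
    calc _ ≤ _ := mul_le_mul_of_nonneg_left h2 hp.le
      _ = _ := by ring
  rw [integral_sub if1 ih, integral_const_mul, integral_const_mul, e1, e2, Real.norm_eq_abs] at key
  have h3 : e2eTail t v u - Real.exp (-t * u - v) = t * ((∫ x in Set.Ioi u,
      Real.exp (-t * x - v * u / x)) - Real.exp (-v) * (Real.exp (-t * u) / t)) := by
    unfold e2eTail
    rw [sub_eq_add_neg (-t * u) v, Real.exp_add]
    field_simp
  rw [h3, abs_mul, abs_of_pos ht]
  calc _ ≤ _ := mul_le_mul_of_nonneg_left key ht.le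
    _ = _ := by
      rw [sub_eq_add_neg (-t * u) v, Real.exp_add]
      field_simp

lemma prod_lim (g : ℕ → ℕ → ℝ) (ε : ℕ → ℝ) (c : ℝ)
    (hg : ∀ᶠ L in atTop, ∀ ℓ, 0 ≤ g L ℓ ∧ g L ℓ ≤ ε L)
    (hε : Tendsto ε atTop (nhds 0))
    (hs : Tendsto (fun L => ∑ ℓ ∈ Finset.range L, g L ℓ) atTop (nhds c)) :
    Tendsto (fun L => ∏ ℓ ∈ Finset.range L, (1 - g L ℓ)) atTop (nhds (Real.exp (-c))) := by
  have up : Tendsto (fun L => Real.exp (-∑ ℓ ∈ Finset.range L, g L ℓ)) atTop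
      (nhds (Real.exp (-c))) := (Real.continuous_exp.tendsto _).comp hs.neg
  have lo : Tendsto (fun L => Real.exp (-((∑ ℓ ∈ Finset.range L, g L ℓ) / (1 - ε L)))) atTop
      (nhds (Real.exp (-c))) := by
    refine (Real.continuous_exp.tendsto _).comp ?_
    have := (hs.div (hε.const_sub 1) (by norm_num)).neg
    simpa using this
  have hε1 : ∀ᶠ L in atTop, ε L < 1 := hε.eventually_lt_const (by norm_num)
  refine tendsto_of_tendsto_of_tendsto_of_le_of_le' lo up ?_ ?_
  · filter_upwards [hg, hε1] with L hL h1
    rw [Finset.sum_div, ← Finset.sum_neg_distrib, Real.exp_sum]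
    refine Finset.prod_le_prod (fun _ _ => (Real.exp_pos _).le) fun ℓ _ => ?_
    obtain ⟨a, b⟩ := hL ℓ
    have hp : 0 < 1 - g L ℓ := by linarith
    rw [← Real.le_log_iff_exp_le hp]
    have h2 := Real.one_sub_inv_le_log_of_pos hp
    have h3 : 1 - (1 - g L ℓ)⁻¹ = - (g L ℓ / (1 - g L ℓ)) := by field_simp; ring
    have h4 : g L ℓ / (1 - g L ℓ) ≤ g L ℓ / (1 - ε L) :=
      div_le_div_of_nonneg_left a (by linarith) (by linarith)
    linarith
  · filter_upwards [hg, hε1] with L hL h1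
    rw [← Finset.sum_neg_distrib, Real.exp_sum]
    refine Finset.prod_le_prod (fun ℓ _ => ?_) fun ℓ _ => ?_
    · linarith [hL ℓ]
    · linarith [Real.add_one_le_exp (-g L ℓ)]

/-- **Main theorem: Gumbel limit of the normalised maximum e2e SNR, fully i.n.i.d. case.**
The first-hop parameters `θ ℓ` take finitely many positive values in `Θ`, the second-hop
parameters `ν ℓ` are bounded, and `β ∈ Θ` satisfies conditions (i)–(iii).  With
`a_L = 1/β` and `b_L = (1/β) log S_L` where `S_L = ∑_{ℓ<L, θℓ=β} exp(-νℓ)`, the CDF of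
the normalised maximum, `∏_{ℓ<L} F_ℓ(a_L γ + b_L)`, converges to `exp(-exp(-γ))`. -/
theorem gumbel_limit_inid (Θ : Finset ℝ) (hΘpos : ∀ t ∈ Θ, 0 < t)
    (β : ℝ) (hβ : β ∈ Θ) (θ : ℕ → ℝ) (hθ : ∀ ℓ, θ ℓ ∈ Θ)
    (ν : ℕ → ℝ) (m M : ℝ) (hν : ∀ ℓ, m ≤ ν ℓ ∧ ν ℓ ≤ M)
    (h1 : Tendsto (fun L : ℕ => (Rcount θ β L : ℝ)) atTop atTop)
    (h2 : ∀ t ∈ Θ, β < t →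
      Tendsto (fun L : ℕ => (Rcount θ t L : ℝ) * (Rcount θ β L : ℝ) ^ (-(t / β)))
        atTop (nhds 0))
    (h3 : ∀ t ∈ Θ, t < β → ∃ C : ℝ, ∀ L : ℕ, (Rcount θ t L : ℝ) ≤ C) :
    ∀ γ : ℝ,
      Tendsto
        (fun L : ℕ =>
          ∏ ℓ ∈ Finset.range L,
            e2eCDF (θ ℓ) (ν ℓ) ((1 / β) * γ + (1 / β) * Real.log (Ssum θ ν β L)))
        atTop (nhds (Real.exp (-Real.exp (-γ)))) := by
  intro γ
  have hβ0 : 0 < β := hΘpos β hβ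
  obtain ⟨K, hK⟩ : ∃ K, ∀ ℓ, |ν ℓ| ≤ K := by
    refine ⟨max |m| |M|, fun ℓ => ?_⟩
    exact abs_le_max_abs_abs (hν ℓ).1 (hν ℓ).2
  have hK0 : 0 ≤ K := (abs_nonneg _).trans (hK 0)
  set C := Real.exp K * K with hC
  have hC0 : 0 ≤ C := by positivity
  have hSlow : ∀ L, (Rcount θ β L : ℝ) * Real.exp (-K) ≤ Ssum θ ν β L := by
    intro L
    unfold Rcount Ssum
    rw [← nsmul_eq_mul]
    refine Finset.card_nsmul_le_sum _ _ _ fun ℓ _ => ?_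
    exact Real.exp_le_exp.2 (by linarith [le_abs_self (ν ℓ), hK ℓ])
  have hS : Tendsto (fun L => Ssum θ ν β L) atTop atTop :=
    tendsto_atTop_mono hSlow (h1.atTop_mul_const (Real.exp_pos _))
  set u : ℕ → ℝ := fun L => (1 / β) * γ + (1 / β) * Real.log (Ssum θ ν β L) with hu
  have hut : Tendsto u atTop atTop :=
    tendsto_atTop_add_const_left _ _ ((Real.tendsto_log_atTop.comp hS).const_mul_atTop (by positivity))
  have hu1 : ∀ᶠ L in atTop, 1 ≤ u L := hut.eventually_ge_atTop 1
  have hexp : ∀ t ∈ Θ, Tendsto (fun L => Real.exp (-t * u L)) atTop (nhds 0) := by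
    intro t ht
    refine Real.tendsto_exp_atBot.comp ?_
    exact hut.const_mul_atTop_of_neg (by linarith [hΘpos t ht])
  -- upper bound
  have hub : ∀ L, 1 ≤ u L → ∀ ℓ, e2eTail (θ ℓ) (ν ℓ) (u L) ≤
      Real.exp (-θ ℓ * u L) * (Real.exp K * (1 + C / θ ℓ)) := by
    intro L hL ℓ
    have ht := hΘpos _ (hθ ℓ)
    have h := (abs_le.1 (e2eTail_approx (θ ℓ) (ν ℓ) (u L) K ht (by linarith) (hK ℓ))).2
    have h' : C / (θ ℓ * u L) ≤ C / θ ℓ :=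
      div_le_div_of_nonneg_left hC0 ht (by nlinarith)
    have h'' : Real.exp (-θ ℓ * u L - ν ℓ) ≤ Real.exp (-θ ℓ * u L) * Real.exp K := by
      rw [← Real.exp_add]
      exact Real.exp_le_exp.2 (by linarith [neg_abs_le (ν ℓ), hK ℓ])
    have hpos : 0 ≤ C / (θ ℓ * u L) := by positivity
    calc e2eTail (θ ℓ) (ν ℓ) (u L)
        ≤ Real.exp (-θ ℓ * u L - ν ℓ) * (1 + C / (θ ℓ * u L)) := by linarith
      _ ≤ (Real.exp (-θ ℓ * u L) * Real.exp K) * (1 + C / θ ℓ) :=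
          mul_le_mul h'' (by linarith) (by linarith) (by positivity)
      _ = _ := by ring
  have hprod := prod_lim (fun L ℓ => e2eTail (θ ℓ) (ν ℓ) (u L))
    (fun L => ∑ t ∈ Θ, Real.exp (-t * u L) * (Real.exp K * (1 + C / t))) (Real.exp (-γ)) ?_ ?_ ?_
  · refine hprod.congr' ?_
    filter_upwards [hu1] with L hL
    refine Finset.prod_congr rfl fun ℓ _ => ?_
    have : 0 < u L := by linarith
    change _ = e2eCDF (θ ℓ) (ν ℓ) (u L)
    rw [e2eCDF, if_pos this, e2eTail]
  · filter_upwards [hu1] with L hL ℓ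
    refine ⟨e2eTail_nonneg _ _ _ (hΘpos _ (hθ ℓ)), (hub L hL ℓ).trans ?_⟩
    refine Finset.single_le_sum
      (f := fun t => Real.exp (-t * u L) * (Real.exp K * (1 + C / t))) (fun t ht => ?_) (hθ ℓ)
    have := hΘpos t ht
    positivity
  · have := tendsto_finsetSum Θ fun t ht => (hexp t ht).mul_const (Real.exp K * (1 + C / t))
    simpa using this
  · have hfib : ∀ L, ∑ t ∈ Θ, ∑ ℓ ∈ (Finset.range L).filter (fun ℓ => θ ℓ = t),
        e2eTail (θ ℓ) (ν ℓ) (u L) = ∑ ℓ ∈ Finset.range L, e2eTail (θ ℓ) (ν ℓ) (u L) := fun L =>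
      Finset.sum_fiberwise_of_maps_to (fun ℓ _ => hθ ℓ) _
    simp only [← hfib]
    have hlim : Real.exp (-γ) = ∑ t ∈ Θ, if t = β then Real.exp (-γ) else 0 := by
      rw [Finset.sum_ite_eq' Θ β, if_pos hβ]
    rw [hlim]
    refine tendsto_finsetSum Θ fun t ht => ?_
    have ht0 := hΘpos t ht
    by_cases htβ : t = β
    · subst htβ
      rw [if_pos rfl]
      have herr : Tendsto (fun L => Real.exp (-γ) * (C / (t * u L))) atTop (nhds 0) := by
        have := ((hut.const_mul_atTop ht0).const_div_atTop C).const_mul (Real.exp (-γ))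
        simpa using this
      have hmain : ∀ᶠ L in atTop, ∑ ℓ ∈ (Finset.range L).filter (fun ℓ => θ ℓ = t),
          Real.exp (-t * u L - ν ℓ) = Real.exp (-γ) := by
        filter_upwards [hS.eventually_gt_atTop 0] with L hL
        have : ∀ ℓ, Real.exp (-t * u L - ν ℓ) = Real.exp (-t * u L) * Real.exp (-ν ℓ) := by
          intro ℓ; rw [← Real.exp_add]; rfl
        simp only [this]
        rw [← Finset.mul_sum]
        change _ * Ssum θ ν t L = _
        have e : -t * u L = -γ - Real.log (Ssum θ ν t L) := by
          simp only [hu]; field_simp; ring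
        rw [e, Real.exp_sub, Real.exp_log hL]
        field_simp
      rw [tendsto_iff_norm_sub_tendsto_zero]
      refine squeeze_zero' (Eventually.of_forall fun _ => norm_nonneg _) ?_ herr
      filter_upwards [hmain, hu1] with L hL hL1
      rw [Real.norm_eq_abs, ← hL, ← Finset.sum_sub_distrib, Finset.sum_mul]
      refine (Finset.abs_sum_le_sum_abs _ _).trans (Finset.sum_le_sum fun ℓ hℓ => ?_)
      rw [(Finset.mem_filter.1 hℓ).2]
      exact e2eTail_approx t (ν ℓ) (u L) K ht0 (by linarith) (hK ℓ)
    · rw [if_neg htβ]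
      have hle : ∀ᶠ L in atTop, ∑ ℓ ∈ (Finset.range L).filter (fun ℓ => θ ℓ = t),
          e2eTail (θ ℓ) (ν ℓ) (u L) ≤
          ((Rcount θ t L : ℝ) * Real.exp (-t * u L)) * (Real.exp K * (1 + C / t)) := by
        filter_upwards [hu1] with L hL
        rw [mul_assoc]
        unfold Rcount
        rw [← nsmul_eq_mul]
        refine Finset.sum_le_card_nsmul _ _ _ fun ℓ hℓ => ?_
        have := hub L hL ℓ
        rwa [(Finset.mem_filter.1 hℓ).2] at this ⊢
      have hz : Tendsto (fun L => (Rcount θ t L : ℝ) * Real.exp (-t * u L)) atTop (nhds 0) := by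
        rcases lt_or_gt_of_ne htβ with hlt | hgt
        · obtain ⟨B, hB⟩ := h3 t ht hlt
          have := (hexp t ht).const_mul B
          rw [mul_zero] at this
          refine squeeze_zero (fun L => by positivity) (fun L => ?_) this
          exact mul_le_mul_of_nonneg_right (hB L) (Real.exp_pos _).le
        · have := (h2 t ht hgt).mul_const (Real.exp (-(t / β) * (γ - K)))
          rw [zero_mul] at this
          refine squeeze_zero' (Eventually.of_forall fun L => by positivity) ?_ this
          filter_upwards [h1.eventually_gt_atTop 0] with L hL
          rw [mul_assoc]
          refine mul_le_mul_of_nonneg_left ?_ (by positivity)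
          rw [Real.rpow_def_of_pos hL, ← Real.exp_add]
          refine Real.exp_le_exp.2 ?_
          have hlog := Real.log_le_log (by positivity) (hSlow L)
          rw [Real.log_mul hL.ne' (Real.exp_pos _).ne', Real.log_exp] at hlog
          have e : -t * u L = -(t / β) * (γ + Real.log (Ssum θ ν β L)) := by
            simp only [hu]; ring
          rw [e]
          have hq : 0 < t / β := by positivity
          nlinarith
      have hz' := hz.mul_const (Real.exp K * (1 + C / t))
      rw [zero_mul] at hz'
      refine squeeze_zero' (Eventually.of_forall fun L => ?_) hle hz'
      exact Finset.sum_nonneg fun ℓ _ => e2eTail_nonneg _ _ _ (hΘpos _ (hθ ℓ))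
end
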